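/- arXiv:1305.6593 — 2 statements merged into one kernel-verified Lean document; each statement's English description precedes it below -/
import Mathlib

section
/- Let n ≥ 1, let a : Fin n → ℂ be injective, and let d ∈ ℂ be nonzero. Set R(d) = {(i,j) : i ≠ j and a(i) − a(j) = r·d for some real r > 0}, and let Sto_d be the set of matrices g ∈ M_n(ℂ) with g_kk = 1 for all k and g_ij = 0 for all i ≠ j with (i,j) ∉ R(d). Then: (a) if (i,j) ∈ R(d) and (j,k) ∈ R(d) then (i,k) ∈ R(d); (b) Sto_d is a subgroup of GL_n(ℂ): every element of Sto_d is invertible, and Sto_d is closed under matrix products and inverses; (c) every g ∈ Sto_d is unipotent, i.e. (g − 1)^n = 0; (d) Sto_d is normalized by the diagonal torus: if t is an invertible diagonal matrix and g ∈ Sto_d then t·g·t⁻¹ ∈ Sto_d. -/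
open Matrix

/-- The set `R(d)` of roots `(i,j)` supported by the direction `d`. -/
def rootsSupported (n : ℕ) (a : Fin n → ℂ) (d : ℂ) : Set (Fin n × Fin n) :=
  {p : Fin n × Fin n | p.1 ≠ p.2 ∧ ∃ r : ℝ, 0 < r ∧ a p.1 - a p.2 = (r : ℂ) * d}

/-- The Stokes group `Sto_d`: matrices with `1`'s on the diagonal whose off-diagonal entries
vanish outside `R(d)`. -/
def stokesGroup (n : ℕ) (a : Fin n → ℂ) (d : ℂ) : Set (Matrix (Fin n) (Fin n) ℂ) :=
  {g : Matrix (Fin n) (Fin n) ℂ |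
    (∀ k, g k k = 1) ∧
    ∀ i j : Fin n, i ≠ j → (i, j) ∉ rootsSupported n a d → g i j = 0}

/-- The roots supported by a direction are closed under composition. -/
theorem rootsSupported_trans {n : ℕ} {a : Fin n → ℂ} {d : ℂ} (hd : d ≠ 0)
    {i j k : Fin n} (hij : (i, j) ∈ rootsSupported n a d)
    (hjk : (j, k) ∈ rootsSupported n a d) : (i, k) ∈ rootsSupported n a d := by
  obtain ⟨-, r, hr, hrd⟩ := hij
  obtain ⟨-, s, hs, hsd⟩ := hjk
  have h : a i - a k = ((r + s : ℝ) : ℂ) * d := by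
    push_cast
    linear_combination hrd + hsd
  refine ⟨fun hik => ?_, r + s, add_pos hr hs, h⟩
  have hik' : i = k := hik
  rw [hik', sub_self] at h
  have hrs : ((r + s : ℝ) : ℂ) ≠ 0 := Complex.ofReal_ne_zero.2 (add_pos hr hs).ne'
  exact mul_ne_zero hrs hd h.symm

/-- A matrix that strictly lowers a grading with values below `m` has vanishing `m`-th power. -/
theorem Matrix.pow_eq_zero_of_lt {ι R : Type*} [Fintype ι] [DecidableEq ι] [Semiring R]
    {N : Matrix ι ι R} (f : ι → ℕ) (hN : ∀ i j, N i j ≠ 0 → f j < f i) {m : ℕ}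
    (hm : ∀ i, f i < m) : N ^ m = 0 := by
  have key : ∀ k i j, (N ^ k) i j ≠ 0 → f j + k ≤ f i := by
    intro k
    induction k with
    | zero =>
      intro i j h
      have hij : i = j := by
        by_contra hne
        exact h (by simp [Matrix.one_apply_ne hne])
      simp [hij]
    | succ k ih =>
      intro i j h
      rw [pow_succ, Matrix.mul_apply] at h
      obtain ⟨l, -, hl⟩ := Finset.exists_ne_zero_of_sum_ne_zero h
      have h₁ := ih i l (left_ne_zero_of_mul hl)
      have h₂ := hN l j (right_ne_zero_of_mul hl)
      omega
  ext i j
  by_contra h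
  have h₁ := key m i j h
  have h₂ := hm i
  omega

/-- Membership in the Stokes group, in terms of the support of `g - 1`. -/
theorem mem_stokesGroup_iff {n : ℕ} {a : Fin n → ℂ} {d : ℂ} {g : Matrix (Fin n) (Fin n) ℂ} :
    g ∈ stokesGroup n a d ↔ ∀ i j, (g - 1) i j ≠ 0 → (i, j) ∈ rootsSupported n a d := by
  constructor
  · rintro ⟨h₁, h₂⟩ i j h
    by_contra hR
    by_cases hij : i = j
    · subst hij
      exact h (by simp [h₁])
    · exact h (by simp [Matrix.one_apply_ne hij, h₂ i j hij hR])
  · intro h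
    refine ⟨fun k => ?_, fun i j hij hR => ?_⟩
    · by_contra hk
      exact (h k k (by simpa [sub_eq_zero] using hk)).1 rfl
    · by_contra hg
      exact hR (h i j (by simpa [Matrix.one_apply_ne hij] using hg))

/-- Matrices supported on `R(d)` are closed under multiplication. -/
theorem mem_rootsSupported_of_mul_apply_ne_zero {n : ℕ} {a : Fin n → ℂ} {d : ℂ}
    (hd : d ≠ 0) {M N : Matrix (Fin n) (Fin n) ℂ}
    (hM : ∀ i j, M i j ≠ 0 → (i, j) ∈ rootsSupported n a d)
    (hN : ∀ i j, N i j ≠ 0 → (i, j) ∈ rootsSupported n a d) (i j : Fin n)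
    (h : (M * N) i j ≠ 0) : (i, j) ∈ rootsSupported n a d := by
  rw [Matrix.mul_apply] at h
  obtain ⟨l, -, hl⟩ := Finset.exists_ne_zero_of_sum_ne_zero h
  exact rootsSupported_trans hd (hM i l (left_ne_zero_of_mul hl))
    (hN l j (right_ne_zero_of_mul hl))

/-- Matrices supported on `R(d)` are closed under addition. -/
theorem mem_rootsSupported_of_add_apply_ne_zero {n : ℕ} {a : Fin n → ℂ} {d : ℂ}
    {M N : Matrix (Fin n) (Fin n) ℂ}
    (hM : ∀ i j, M i j ≠ 0 → (i, j) ∈ rootsSupported n a d)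
    (hN : ∀ i j, N i j ≠ 0 → (i, j) ∈ rootsSupported n a d) (i j : Fin n)
    (h : (M + N) i j ≠ 0) : (i, j) ∈ rootsSupported n a d := by
  by_contra hR
  exact h (by
    rw [Matrix.add_apply, not_not.1 (mt (hM i j) hR), not_not.1 (mt (hN i j) hR), add_zero])

/-- The Stokes group is closed under products. -/
theorem mul_mem_stokesGroup {n : ℕ} {a : Fin n → ℂ} {d : ℂ} (hd : d ≠ 0)
    {g h : Matrix (Fin n) (Fin n) ℂ} (hg : g ∈ stokesGroup n a d)
    (hh : h ∈ stokesGroup n a d) : g * h ∈ stokesGroup n a d := by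
  rw [mem_stokesGroup_iff] at hg hh ⊢
  have e : g * h - 1 = (g - 1) * (h - 1) + ((g - 1) + (h - 1)) := by noncomm_ring
  rw [e]
  exact mem_rootsSupported_of_add_apply_ne_zero
    (mem_rootsSupported_of_mul_apply_ne_zero hd hg hh)
    (mem_rootsSupported_of_add_apply_ne_zero hg hh)

/-- A matrix supported on `R(d)` is nilpotent. -/
theorem pow_eq_zero_of_support_subset_rootsSupported {n : ℕ} {a : Fin n → ℂ} {d : ℂ}
    (hd : d ≠ 0) {N : Matrix (Fin n) (Fin n) ℂ}
    (hN : ∀ i j, N i j ≠ 0 → (i, j) ∈ rootsSupported n a d) : N ^ n = 0 := by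
  classical
  refine Matrix.pow_eq_zero_of_lt
    (fun i => (Finset.univ.filter fun j => (i, j) ∈ rootsSupported n a d).card)
    (fun i j h => Finset.card_lt_card ?_) (fun i => ?_)
  · have hij := hN i j h
    refine (Finset.ssubset_iff_of_subset fun k hk => ?_).2 ⟨j, ?_, ?_⟩
    · simp only [Finset.mem_filter, Finset.mem_univ, true_and] at hk ⊢
      exact rootsSupported_trans hd hij hk
    · simpa using hij
    · simpa using fun hjj : (j, j) ∈ rootsSupported n a d => hjj.1 rfl
  · have hlt := Finset.card_lt_univ_of_notMem
      (s := Finset.univ.filter fun j => (i, j) ∈ rootsSupported n a d) (x := i)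
      (by simpa using fun hii : (i, i) ∈ rootsSupported n a d => hii.1 rfl)
    simpa using hlt

/-- Every element of the Stokes group has a right inverse in the Stokes group. -/
theorem exists_mul_eq_one_of_mem_stokesGroup {n : ℕ} {a : Fin n → ℂ} {d : ℂ}
    (hd : d ≠ 0) {g : Matrix (Fin n) (Fin n) ℂ}
    (hg : g ∈ stokesGroup n a d) : ∃ h ∈ stokesGroup n a d, g * h = 1 := by
  rw [mem_stokesGroup_iff] at hg
  have hN : ∀ i j, (1 - g) i j ≠ 0 → (i, j) ∈ rootsSupported n a d := fun i j h =>
    hg i j (by rw [← neg_sub, Matrix.neg_apply]; exact neg_ne_zero.2 h)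
  have hsum : ∀ k, (∑ l ∈ Finset.range k, (1 - g) ^ l) * (1 - g) + 1 ∈ stokesGroup n a d := by
    intro k
    induction k with
    | zero => exact mem_stokesGroup_iff.2 (by simp)
    | succ k ih =>
      rw [mem_stokesGroup_iff, add_sub_cancel_right] at ih ⊢
      have e : (∑ l ∈ Finset.range (k + 1), (1 - g) ^ l) * (1 - g) =
          (∑ l ∈ Finset.range k, (1 - g) ^ l) * (1 - g) * (1 - g) + (1 - g) := by
        rw [Finset.sum_range_succ', Finset.sum_congr rfl fun l _ => pow_succ (1 - g) l,
          ← Finset.sum_mul, pow_zero, add_mul, one_mul]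
      rw [e]
      exact mem_rootsSupported_of_add_apply_ne_zero
        (mem_rootsSupported_of_mul_apply_ne_zero hd ih hN) hN
  refine ⟨_, hsum n, ?_⟩
  have e : (∑ l ∈ Finset.range n, (1 - g) ^ l) * (1 - g) + 1 =
      ∑ l ∈ Finset.range (n + 1), (1 - g) ^ l := by
    rw [Finset.sum_range_succ', Finset.sum_congr rfl fun l _ => pow_succ (1 - g) l,
      ← Finset.sum_mul, pow_zero]
  have hgeom := mul_neg_geom_sum (1 - g) (n + 1)
  rwa [sub_sub_cancel, pow_succ, pow_eq_zero_of_support_subset_rootsSupported hd hN,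
    zero_mul, sub_zero, ← e] at hgeom

/-- The Stokes group is normalized by invertible diagonal matrices. -/
theorem diagonal_conj_mem_stokesGroup {n : ℕ} {a : Fin n → ℂ} {d : ℂ} {c : Fin n → ℂ}
    (hc : ∀ i, c i ≠ 0) {g : Matrix (Fin n) (Fin n) ℂ} (hg : g ∈ stokesGroup n a d) :
    Matrix.diagonal c * g * (Matrix.diagonal c)⁻¹ ∈ stokesGroup n a d := by
  have hinv : (Matrix.diagonal c)⁻¹ = Matrix.diagonal fun i => (c i)⁻¹ :=
    Matrix.inv_eq_right_inv (by simp [Matrix.diagonal_mul_diagonal, hc])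
  rw [hinv]
  refine ⟨fun k => ?_, fun i j hij hR => ?_⟩
  · simp [Matrix.mul_diagonal, Matrix.diagonal_mul, hg.1 k, hc k]
  · simp [Matrix.mul_diagonal, Matrix.diagonal_mul, hg.2 i j hij hR]

/-- `Sto_d` is a unipotent subgroup of `GL_n(ℂ)` normalized by the diagonal torus:
(a) `R(d)` is transitively closed; (b) elements of `Sto_d` are invertible and `Sto_d` is
closed under products and inverses; (c) elements of `Sto_d` are unipotent; (d) `Sto_d` is
normalized by invertible diagonal matrices. -/
theorem stokesGroup_is_unipotent_subgroup (n : ℕ) (hn : 1 ≤ n)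
    (a : Fin n → ℂ) (ha : Function.Injective a) (d : ℂ) (hd : d ≠ 0) :
    (∀ i j k : Fin n, (i, j) ∈ rootsSupported n a d → (j, k) ∈ rootsSupported n a d →
      (i, k) ∈ rootsSupported n a d) ∧
    (∀ g ∈ stokesGroup n a d, IsUnit g) ∧
    (∀ g ∈ stokesGroup n a d, ∀ h ∈ stokesGroup n a d, g * h ∈ stokesGroup n a d) ∧
    (∀ g ∈ stokesGroup n a d, g⁻¹ ∈ stokesGroup n a d) ∧
    (∀ g ∈ stokesGroup n a d, (g - 1) ^ n = 0) ∧
    (∀ c : Fin n → ℂ, (∀ i, c i ≠ 0) → ∀ g ∈ stokesGroup n a d,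
      Matrix.diagonal c * g * (Matrix.diagonal c)⁻¹ ∈ stokesGroup n a d) := by
  refine ⟨fun i j k => rootsSupported_trans hd, fun g hg => ?_,
    fun g hg h hh => mul_mem_stokesGroup hd hg hh, fun g hg => ?_,
    fun g hg => pow_eq_zero_of_support_subset_rootsSupported hd (mem_stokesGroup_iff.1 hg),
    fun c hc g hg => diagonal_conj_mem_stokesGroup hc hg⟩
  · obtain ⟨h, -, hgh⟩ := exists_mul_eq_one_of_mem_stokesGroup hd hg
    exact IsUnit.of_mul_eq_one h hgh
  · obtain ⟨h, hh, hgh⟩ := exists_mul_eq_one_of_mem_stokesGroup hd hg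
    rwa [Matrix.inv_eq_right_inv hgh]
end

section
/- Let n ≥ 1, let a⁰ ∈ ℂⁿ have pairwise distinct coordinates, and let B⁰ ∈ M_n(ℂ). Then there exist an open neighbourhood U of a⁰ contained in {a ∈ ℂⁿ : a_i ≠ a_j for all i ≠ j} and a holomorphic map B : U → M_n(ℂ) with B(a⁰) = B⁰ such that for every a ∈ U and every k ∈ {1,…,n} the partial derivative of B in the k-th coordinate direction satisfies ∂B/∂a_k = [B(a), Θ^(k)(a)], where Θ^(k)(a) ∈ M_n(ℂ) is given by Θ^(k)(a)_ij = (δ_ik − δ_jk)·B(a)_ij/(a_i − a_j) for i ≠ j and Θ^(k)(a)_ii = 0. In other words, the isomonodromy system admits a local solution through every initial condition (it defines a flat nonlinear connection over 𝔱_reg). -/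
open Matrix

/-- The matrix `Θ^(k)(a)` of the simply-laced isomonodromy system:
`Θ^(k)_ij = (δ_ik − δ_jk)·B_ij/(a_i − a_j)` off the diagonal, `Θ^(k)_ii = 0`. -/
noncomputable def isomonodromyThetaK (n : ℕ) (k : Fin n)
    (B : (Fin n → ℂ) → Matrix (Fin n) (Fin n) ℂ) (a : Fin n → ℂ) :
    Matrix (Fin n) (Fin n) ℂ :=
  Matrix.of fun i j =>
    if i = j then 0
    else (((if i = k then (1 : ℂ) else 0) - (if j = k then (1 : ℂ) else 0)) * B a i j)
      / (a i - a j)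

section Algebra

variable {ι R : Type*}

/-- The difference quotients `(k i - k j) / (a i - a j)`. -/
def diffQuot [Field R] (a k : ι → R) (i j : ι) : R := (k i - k j) * (a i - a j)⁻¹

theorem diffQuot_collinear [Field R] {a : ι → R} (ha : ∀ i j, i ≠ j → a i ≠ a j) (h k : ι → R)
    (i l j : ι) :
    diffQuot a h i l * diffQuot a k l j - diffQuot a k i l * diffQuot a h l j
      + diffQuot a k i j * (diffQuot a h l j - diffQuot a h i l)
      - diffQuot a h i j * (diffQuot a k l j - diffQuot a k i l) = 0 := by
  unfold diffQuot
  rcases eq_or_ne i l with rfl | hil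
  · simp only [sub_self]; ring
  rcases eq_or_ne l j with rfl | hlj
  · simp only [sub_self]; ring
  rcases eq_or_ne i j with rfl | hij
  · rw [← neg_sub (a i) (a l), inv_neg]; ring
  have h1 := sub_ne_zero.2 (ha _ _ hil)
  have h2 := sub_ne_zero.2 (ha _ _ hlj)
  have h3 := sub_ne_zero.2 (ha _ _ hij)
  field_simp
  ring

variable [Fintype ι]

/-- The entries of `[u, ρ ⊙ u]`. -/
def hadamardBracket [CommRing R] (ρ u : ι → ι → R) (i j : ι) : R :=
  ∑ l, (ρ l j - ρ i l) * (u i l * u l j)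

/-- The derivative of `hadamardBracket ρ` at `u` in the direction `w`. -/
def hadamardBracketDeriv [CommRing R] (ρ u w : ι → ι → R) (i j : ι) : R :=
  ∑ l, (ρ l j - ρ i l) * (w i l * u l j + u i l * w l j)

theorem hadamardBracket_eq [CommRing R] (ρ u : Matrix ι ι R) :
    of (hadamardBracket ρ u) = u * (ρ ⊙ u) - (ρ ⊙ u) * u := by
  ext i j
  simp only [hadamardBracket, of_apply, Matrix.sub_apply, mul_apply, hadamard_apply,
    ← Finset.sum_sub_distrib]
  exact Finset.sum_congr rfl fun l _ => by ring

theorem hadamardBracketDeriv_eq [CommRing R] (ρ u w : Matrix ι ι R) :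
    of (hadamardBracketDeriv ρ u w) =
      w * (ρ ⊙ u) - (ρ ⊙ u) * w + (u * (ρ ⊙ w) - (ρ ⊙ w) * u) := by
  ext i j
  simp only [hadamardBracketDeriv, of_apply, Matrix.sub_apply, Matrix.add_apply, mul_apply,
    hadamard_apply, ← Finset.sum_sub_distrib, ← Finset.sum_add_distrib]
  exact Finset.sum_congr rfl fun l _ => by ring

theorem hadamardBracketDeriv_sub_smul [CommRing R] (ρ u v w : ι → ι → R) (c : R) (i j : ι) :
    hadamardBracketDeriv ρ u (fun i j => v i j - c * w i j) i j =
      hadamardBracketDeriv ρ u v i j - c * hadamardBracketDeriv ρ u w i j := by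
  simp only [hadamardBracketDeriv, Finset.mul_sum, ← Finset.sum_sub_distrib]
  exact Finset.sum_congr rfl fun l _ => by ring

/-- Flatness of the isomonodromy connection. -/
theorem hadamardBracketDeriv_comm [Field R] {a : ι → R} (ha : ∀ i j, i ≠ j → a i ≠ a j)
    (h k : ι → R) (u : ι → ι → R) :
    hadamardBracketDeriv (diffQuot a k) u (hadamardBracket (diffQuot a h) u) =
      hadamardBracketDeriv (diffQuot a h) u (hadamardBracket (diffQuot a k) u) := by
  let U : Matrix ι ι R := of u
  let ρ : Matrix ι ι R := of (diffQuot a h)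
  let σ : Matrix ι ι R := of (diffQuot a k)
  have key : (ρ ⊙ U) * (σ ⊙ U) - (σ ⊙ U) * (ρ ⊙ U) + σ ⊙ (U * (ρ ⊙ U) - (ρ ⊙ U) * U)
      - ρ ⊙ (U * (σ ⊙ U) - (σ ⊙ U) * U) = 0 := by
    ext i j
    simp only [Matrix.sub_apply, Matrix.add_apply, mul_apply, hadamard_apply, Matrix.zero_apply,
      ← Finset.sum_sub_distrib, ← Finset.sum_add_distrib, Finset.mul_sum, U, ρ, σ, of_apply]
    refine Finset.sum_eq_zero fun l _ => ?_
    linear_combination (u i l * u l j) * diffQuot_collinear ha h k i l j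
  have e1 := hadamardBracketDeriv_eq σ U (of (hadamardBracket ρ U))
  have e2 := hadamardBracketDeriv_eq ρ U (of (hadamardBracket σ U))
  refine (of (m := ι) (n := ι) (α := R)).injective (e1.trans (Eq.trans ?_ e2.symm))
  rw [hadamardBracket_eq, hadamardBracket_eq, ← sub_eq_zero]
  have := congrArg (fun M => U * M - M * U) key
  simp only [mul_zero, zero_mul, sub_self] at this
  rw [← this]
  noncomm_ring

end Algebra

section ODE

open Set

variable {ι : Type*}

theorem hasDerivAt_diffQuot_line {a h : ι → ℂ} (k : ι → ℂ) {t : ℝ}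
    (ha : ∀ i j, i ≠ j → (a + (t : ℂ) • h) i ≠ (a + (t : ℂ) • h) j) (i j : ι) :
    HasDerivAt (fun s : ℝ => diffQuot (a + (s : ℂ) • h) k i j)
      (-(diffQuot (a + (t : ℂ) • h) h i j * diffQuot (a + (t : ℂ) • h) k i j)) t := by
  unfold diffQuot
  rcases eq_or_ne i j with rfl | hij
  · simpa using hasDerivAt_const t (0 : ℂ)
  have h1 (i : ι) : HasDerivAt (fun s : ℝ => (a + (s : ℂ) • h) i) (h i) t := by
    simpa using ((hasDerivAt_id t).ofReal_comp.mul_const (h i)).const_add (a i)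
  have hne := sub_ne_zero.2 (ha i j hij)
  refine (((h1 i).fun_sub (h1 j)).fun_inv hne |>.const_mul (k i - k j)).congr_deriv ?_
  rw [div_eq_mul_inv, ← inv_pow]
  ring

variable [Fintype ι]

theorem norm_hadamardBracketDeriv_le (ρ u w : ι → ι → ℂ) :
    ‖hadamardBracketDeriv ρ u w‖ ≤
      (∑ i, ∑ j, ∑ l, ‖ρ l j - ρ i l‖ * (‖u l j‖ + ‖u i l‖)) * ‖w‖ := by
  have hw (i j : ι) : ‖w i j‖ ≤ ‖w‖ := (norm_le_pi_norm (w i) j).trans (norm_le_pi_norm w i)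
  have hnn : 0 ≤ (∑ i, ∑ j, ∑ l, ‖ρ l j - ρ i l‖ * (‖u l j‖ + ‖u i l‖)) * ‖w‖ := by positivity
  refine (pi_norm_le_iff_of_nonneg hnn).2 fun i => (pi_norm_le_iff_of_nonneg hnn).2 fun j => ?_
  calc ‖hadamardBracketDeriv ρ u w i j‖
      ≤ ∑ l, ‖ρ l j - ρ i l‖ * (‖u l j‖ + ‖u i l‖) * ‖w‖ := by
        refine norm_sum_le_of_le _ fun l _ => ?_
        rw [norm_mul, mul_assoc]
        gcongr
        refine (norm_add_le _ _).trans ?_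
        rw [norm_mul, norm_mul, add_mul, mul_comm ‖w i l‖]
        gcongr <;> apply hw
    _ = (∑ l, ‖ρ l j - ρ i l‖ * (‖u l j‖ + ‖u i l‖)) * ‖w‖ := by rw [Finset.sum_mul]
    _ ≤ _ := by
        refine mul_le_mul_of_nonneg_right ?_ (norm_nonneg w)
        refine le_trans ?_ (Finset.single_le_sum (f := fun i => ∑ j, ∑ l,
          ‖ρ l j - ρ i l‖ * (‖u l j‖ + ‖u i l‖)) (fun _ _ => by positivity) (Finset.mem_univ i))
        exact Finset.single_le_sum (f := fun j => ∑ l,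
          ‖ρ l j - ρ i l‖ * (‖u l j‖ + ‖u i l‖)) (fun _ _ => by positivity) (Finset.mem_univ j)

/-- If `u` solves the isomonodromy system along the ray `a + t h` and `v` solves its linearization
in the direction `k` of the parameter `h`, then `v t = t • [u, Θ]` with `Θ` taken in the
direction `k`. -/
theorem ray_variation_eq {a h k : ι → ℂ} {u v : ℝ → ι → ι → ℂ}
    (ha : ∀ t ∈ Icc (0 : ℝ) 1, ∀ i j, i ≠ j → (a + (t : ℂ) • h) i ≠ (a + (t : ℂ) • h) j)
    (hu : ∀ t ∈ Icc (0 : ℝ) 1, ∀ i j, HasDerivAt (fun s => u s i j)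
      (hadamardBracket (diffQuot (a + (t : ℂ) • h) h) (u t) i j) t)
    (hv : ∀ t ∈ Icc (0 : ℝ) 1, ∀ i j, HasDerivAt (fun s => v s i j)
      (hadamardBracket (diffQuot (a + (t : ℂ) • h) k) (u t) i j
        + t * hadamardBracket (fun i j => -(diffQuot (a + (t : ℂ) • h) h i j *
            diffQuot (a + (t : ℂ) • h) k i j)) (u t) i j
        + hadamardBracketDeriv (diffQuot (a + (t : ℂ) • h) h) (u t) (v t) i j) t)
    (hv0 : v 0 = 0) :
    v 1 = hadamardBracket (diffQuot (a + h) k) (u 1) := by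
  set f : ℝ → ι → ι → ℂ := fun t i j =>
    v t i j - t * hadamardBracket (diffQuot (a + (t : ℂ) • h) k) (u t) i j with hf
  have hfd : ∀ t ∈ Icc (0 : ℝ) 1, HasDerivAt f
      (hadamardBracketDeriv (diffQuot (a + (t : ℂ) • h) h) (u t) (f t)) t := by
    intro t ht
    refine hasDerivAt_pi.2 fun i => hasDerivAt_pi.2 fun j => ?_
    have hX : HasDerivAt (fun s : ℝ => hadamardBracket (diffQuot (a + (s : ℂ) • h) k) (u s) i j)
        (hadamardBracket (fun i j => -(diffQuot (a + (t : ℂ) • h) h i j *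
            diffQuot (a + (t : ℂ) • h) k i j)) (u t) i j
          + hadamardBracketDeriv (diffQuot (a + (t : ℂ) • h) k) (u t)
            (hadamardBracket (diffQuot (a + (t : ℂ) • h) h) (u t)) i j) t := by
      simp only [hadamardBracket, hadamardBracketDeriv, ← Finset.sum_add_distrib]
      refine HasDerivAt.fun_sum fun l _ => ?_
      exact ((hasDerivAt_diffQuot_line k (ha t ht) l j).fun_sub
        (hasDerivAt_diffQuot_line k (ha t ht) i l)).fun_mul
          ((hu t ht i l).fun_mul (hu t ht l j))
    refine ((hv t ht i j).fun_sub ((hasDerivAt_id t).ofReal_comp.fun_mul hX)).congr_deriv ?_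
    rw [hf, hadamardBracketDeriv_sub_smul, ← hadamardBracketDeriv_comm (ha t ht) h k (u t)]
    simp only [id, Complex.ofReal_one]
    ring
  have hcu (i j : ι) : ContinuousOn (fun s => u s i j) (Icc 0 1) := fun t ht =>
    (hu t ht i j).continuousAt.continuousWithinAt
  have hcq (i j : ι) : ContinuousOn (fun s : ℝ => diffQuot (a + (s : ℂ) • h) h i j) (Icc 0 1) :=
    fun t ht => (hasDerivAt_diffQuot_line h (ha t ht) i j).continuousAt.continuousWithinAt
  have hcont : ContinuousOn (fun t : ℝ => ∑ i, ∑ j, ∑ l,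
      ‖diffQuot (a + (t : ℂ) • h) h l j - diffQuot (a + (t : ℂ) • h) h i l‖ *
        (‖u t l j‖ + ‖u t i l‖)) (Icc 0 1) :=
    continuousOn_finsetSum _ fun i _ => continuousOn_finsetSum _ fun j _ =>
      continuousOn_finsetSum _ fun l _ => ((hcq l j).sub (hcq i l)).norm.mul
        ((hcu l j).norm.add (hcu i l).norm)
  obtain ⟨K, hK⟩ := isCompact_Icc.exists_bound_of_continuousOn hcont
  have hz := eq_zero_of_abs_deriv_le_mul_abs_self_of_eq_zero_right (f := f) (K := K)
    (fun t ht => (hfd t ht).continuousAt.continuousWithinAt)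
    (fun t ht => (hfd t (Ico_subset_Icc_self ht)).hasDerivWithinAt)
    (by ext i j; simp [hf, hv0])
    (fun t ht => (norm_hadamardBracketDeriv_le _ _ _).trans (by
      gcongr
      exact (le_abs_self _).trans (hK t (Ico_subset_Icc_self ht)))) 1 (right_mem_Icc.2 zero_le_one)
  ext i j
  have := congrFun (congrFun hz i) j
  simpa [hf, sub_eq_zero] using this

end ODE

section UnitInterval

open Set unitInterval Topology

/-- The primitive vanishing at `0` of a continuous function on the unit interval. -/
noncomputable def unitIntervalPrimitive : C(I, ℂ) →L[ℂ] C(I, ℂ) :=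
  LinearMap.mkContinuous
    { toFun := fun f =>
        ⟨fun t => ∫ s in (0 : ℝ)..t, IccExtend zero_le_one f s,
          (intervalIntegral.continuous_primitive
            (fun _ _ => f.continuous.Icc_extend'.intervalIntegrable _ _) 0).comp
              continuous_subtype_val⟩
      map_add' := fun f g => by
        ext t
        exact intervalIntegral.integral_add (f.continuous.Icc_extend'.intervalIntegrable _ _)
          (g.continuous.Icc_extend'.intervalIntegrable _ _)
      map_smul' := fun c f => by
        ext t
        exact intervalIntegral.integral_smul c _ } 1
    fun f => by
      refine (ContinuousMap.norm_le _ (by positivity)).2 fun t => ?_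
      refine (intervalIntegral.norm_integral_le_of_norm_le_const (C := ‖f‖)
        fun s _ => f.norm_coe_le_norm _).trans ?_
      rw [sub_zero, abs_of_nonneg t.2.1, one_mul]
      exact mul_le_of_le_one_right (norm_nonneg f) t.2.2

theorem hasDerivAt_integral_IccExtend (f : C(I, ℂ)) (t : I) :
    HasDerivAt (fun x : ℝ => ∫ s in (0 : ℝ)..x, IccExtend zero_le_one f s) (f t) t := by
  have hc : Continuous (IccExtend (zero_le_one' ℝ) f) := f.continuous.Icc_extend'
  have := hc.integral_hasStrictDerivAt 0 (t : ℝ)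
  rw [IccExtend_val] at this
  exact this.hasDerivAt

/-- The coordinate of the unit interval, as a complex-valued function. -/
def unitIntervalCoord : C(I, ℂ) := ⟨fun t => ((t : ℝ) : ℂ), by fun_prop⟩

section Ray

variable {ι : Type*} [DecidableEq ι]

/-- The function `t ↦ (a + t h) i - (a + t h) j` on the unit interval, replaced by `1` on the
diagonal so as to be invertible. -/
noncomputable def rayDenom (a h : ι → ℂ) (i j : ι) : C(I, ℂ) :=
  if i = j then 1 else ContinuousMap.const I (a i - a j) + (h i - h j) • unitIntervalCoord

/-- The function `t ↦ diffQuot (a + t h) k i j` on the unit interval. -/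
noncomputable def rayQuot (a h k : ι → ℂ) (i j : ι) : C(I, ℂ) :=
  (k i - k j) • Ring.inverse (rayDenom a h i j)

theorem rayDenom_apply {i j : ι} (hij : i ≠ j) (a h : ι → ℂ) (t : I) :
    rayDenom a h i j t = (a + (t : ℂ) • h) i - (a + (t : ℂ) • h) j := by
  simp [rayDenom, hij, unitIntervalCoord]
  ring

theorem rayDenom_ne {a h : ι → ℂ} (hd : ∀ i j, IsUnit (rayDenom a h i j)) (t : I) (i j : ι)
    (hij : i ≠ j) : (a + (t : ℂ) • h) i ≠ (a + (t : ℂ) • h) j := by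
  rw [← sub_ne_zero, ← rayDenom_apply hij]
  obtain ⟨x, hx⟩ := (hd i j).exists_right_inv
  exact left_ne_zero_of_mul_eq_one (DFunLike.congr_fun hx t)

theorem rayQuot_apply {a h : ι → ℂ} (hd : ∀ i j, IsUnit (rayDenom a h i j)) (k : ι → ℂ)
    (i j : ι) (t : I) : rayQuot a h k i j t = diffQuot (a + (t : ℂ) • h) k i j := by
  rcases eq_or_ne i j with rfl | hij
  · simp [rayQuot, diffQuot]
  have := DFunLike.congr_fun (Ring.inverse_mul_cancel _ (hd i j)) t
  rw [ContinuousMap.mul_apply, ContinuousMap.one_apply] at this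
  rw [rayQuot, diffQuot, ContinuousMap.smul_apply, eq_inv_of_mul_eq_one_left this,
    rayDenom_apply hij, smul_eq_mul]

theorem isUnit_rayDenom_zero {a : ι → ℂ} (ha : ∀ i j, i ≠ j → a i ≠ a j) (i j : ι) :
    IsUnit (rayDenom a 0 i j) := by
  rcases eq_or_ne i j with rfl | hij
  · simp [rayDenom]
  · rw [ContinuousMap.isUnit_iff_forall_ne_zero]
    intro t
    rw [rayDenom_apply hij]
    simpa [sub_eq_zero] using ha i j hij

theorem hasDerivAt_rayDenom_line (a h k : ι → ℂ) (i j : ι) :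
    HasDerivAt (fun ε : ℂ => rayDenom a (h + ε • k) i j) ((k i - k j) • unitIntervalCoord) 0 := by
  unfold rayDenom
  split_ifs with hij
  · rw [hij, sub_self, zero_smul ℂ unitIntervalCoord]
    exact hasDerivAt_const _ _
  have hl (i : ι) : HasDerivAt (fun ε : ℂ => (h + ε • k) i) (k i) 0 := by
    simpa using ((hasDerivAt_id (0 : ℂ)).mul_const (k i)).const_add (h i)
  exact (((hl i).fun_sub (hl j)).smul_const unitIntervalCoord).const_add _

theorem hasDerivAt_rayQuot_line {a h : ι → ℂ} (hd : ∀ i j, IsUnit (rayDenom a h i j))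
    (k : ι → ℂ) (i j : ι) :
    HasDerivAt (fun ε : ℂ => rayQuot a (h + ε • k) (h + ε • k) i j)
      (rayQuot a h k i j - unitIntervalCoord * (rayQuot a h h i j * rayQuot a h k i j)) 0 := by
  obtain ⟨x, hx⟩ := hd i j
  have hl (i : ι) : HasDerivAt (fun ε : ℂ => (h + ε • k) i) (k i) 0 := by
    simpa using ((hasDerivAt_id (0 : ℂ)).mul_const (k i)).const_add (h i)
  have hx' : rayDenom a (h + (0 : ℂ) • k) i j = x := by rw [zero_smul, add_zero, hx]
  have hinv : HasFDerivAt Ring.inverse (-ContinuousLinearMap.mulLeftRight ℂ C(I, ℂ) ↑x⁻¹ ↑x⁻¹)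
      (rayDenom a (h + (0 : ℂ) • k) i j) := hx' ▸ hasFDerivAt_ringInverse x
  refine (((hl i).fun_sub (hl j)).fun_smul
    (hinv.comp_hasDerivAt 0 (hasDerivAt_rayDenom_line a h k i j))).congr_deriv ?_
  simp only [rayQuot, Function.comp_apply, ← hx, Ring.inverse_unit, zero_smul, add_zero,
    _root_.neg_apply, ContinuousLinearMap.mulLeftRight_apply]
  ext t
  simp
  ring

variable [Fintype ι]

theorem contDiff_rayDenom (a : ι → ℂ) (i j : ι) :
    ContDiff ℂ 1 (fun h => rayDenom a h i j) := by
  unfold rayDenom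
  split_ifs <;> fun_prop

/-- The integral equation for solutions of the isomonodromy system along the rays `a + t h`, as
the vanishing of a map on a Banach space. -/
noncomputable def rayEquation (a : ι → ℂ) (b : ι → ι → ℂ)
    (x : (ι → ℂ) × (ι → ι → C(I, ℂ))) (i j : ι) : C(I, ℂ) :=
  x.2 i j - ContinuousMap.const I (b i j)
    - unitIntervalPrimitive (hadamardBracket (rayQuot a x.1 x.1) x.2 i j)

theorem rayEquation_zero (a : ι → ℂ) (b : ι → ι → ℂ) (γ : ι → ι → C(I, ℂ)) :
    rayEquation a b (0, γ) = γ - fun i j => ContinuousMap.const I (b i j) := by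
  ext i j : 2
  have hq (i j : ι) : rayQuot a 0 0 i j = 0 := by
    rw [rayQuot, Pi.zero_apply, Pi.zero_apply, sub_self]
    exact zero_smul ℂ (Ring.inverse (rayDenom a 0 i j))
  simp [rayEquation, hadamardBracket, hq]

theorem contDiffAt_rayEquation {a : ι → ℂ} (ha : ∀ i j, i ≠ j → a i ≠ a j) (b : ι → ι → ℂ)
    (γ : ι → ι → C(I, ℂ)) : ContDiffAt ℂ 1 (rayEquation a b) (0, γ) := by
  have hq (i j : ι) : ContDiffAt ℂ 1 (fun x : (ι → ℂ) × (ι → ι → C(I, ℂ)) =>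
      rayQuot a x.1 x.1 i j) (0, γ) := by
    obtain ⟨x, hx⟩ := isUnit_rayDenom_zero ha i j
    have hinv : ContDiffAt ℂ 1 Ring.inverse (rayDenom a (0, γ).1 i j) :=
      hx ▸ contDiffAt_ringInverse ℂ x
    have := hinv.comp (0, γ) ((contDiff_rayDenom a i j).comp contDiff_fst).contDiffAt
    have hk : ContDiffAt ℂ 1 (fun x : (ι → ℂ) × (ι → ι → C(I, ℂ)) => x.1 i - x.1 j) (0, γ) := by
      fun_prop
    exact hk.smul this
  refine contDiffAt_pi.2 fun i => contDiffAt_pi.2 fun j => ?_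
  refine ContDiffAt.sub (by fun_prop) (unitIntervalPrimitive.contDiff.contDiffAt.comp _ ?_)
  refine ContDiffAt.sum fun l _ => ((hq l j).sub (hq i l)).mul (by fun_prop)

theorem exists_rayEquation_solution {a : ι → ℂ} (ha : ∀ i j, i ≠ j → a i ≠ a j)
    (b : ι → ι → ℂ) :
    ∃ γ : (ι → ℂ) → ι → ι → C(I, ℂ), (γ 0 = fun i j => ContinuousMap.const I (b i j)) ∧
      ∀ᶠ h in 𝓝 0, DifferentiableAt ℂ γ h ∧ (∀ i j, IsUnit (rayDenom a h i j)) ∧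
        rayEquation a b (h, γ h) = 0 := by
  set γ₀ : ι → ι → C(I, ℂ) := fun i j => ContinuousMap.const I (b i j) with hγ₀
  have hF := contDiffAt_rayEquation ha b γ₀
  have hinr : fderiv ℂ (rayEquation a b) (0, γ₀) ∘L .inr ℂ _ _ = .id ℂ _ := by
    have h1 : HasFDerivAt (fun γ => rayEquation a b (0, γ))
        (fderiv ℂ (rayEquation a b) (0, γ₀) ∘L .inr ℂ _ _) γ₀ :=
      (hF.differentiableAt one_ne_zero).hasFDerivAt.comp γ₀ (hasFDerivAt_prodMk_right 0 γ₀)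
    simp only [rayEquation_zero] at h1
    exact h1.unique ((hasFDerivAt_id γ₀).sub_const _)
  have hinv : (fderiv ℂ (rayEquation a b) (0, γ₀) ∘L .inr ℂ _ _).IsInvertible := by
    rw [hinr]
    exact ⟨.refl ℂ _, rfl⟩
  refine ⟨hF.implicitFunction one_ne_zero hinv,
    hF.implicitFunction_apply_self one_ne_zero hinv, ?_⟩
  have hu : ∀ᶠ h in 𝓝 (0 : ι → ℂ), ∀ i j, IsUnit (rayDenom a h i j) :=
    Filter.eventually_all.2 fun i => Filter.eventually_all.2 fun j =>
      (contDiff_rayDenom a i j).continuous.continuousAt.eventually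
        (Units.isOpen.mem_nhds (isUnit_rayDenom_zero ha i j))
  filter_upwards [(hF.contDiffAt_implicitFunction one_ne_zero hinv).eventually (by simp), hu,
    hF.eventually_apply_implicitFunction one_ne_zero hinv] with h h1 h2 h3
  refine ⟨h1.differentiableAt one_ne_zero, h2, h3.trans ?_⟩
  rw [rayEquation_zero, hγ₀, sub_self]

theorem rayEquation_variation {a : ι → ℂ} {b : ι → ι → ℂ} {γ : (ι → ℂ) → ι → ι → C(I, ℂ)}
    {h : ι → ℂ} (hγ : DifferentiableAt ℂ γ h) (hd : ∀ i j, IsUnit (rayDenom a h i j))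
    (heq : ∀ᶠ x in 𝓝 h, rayEquation a b (x, γ x) = 0) (k : ι → ℂ) (i j : ι) :
    fderiv ℂ γ h k i j = unitIntervalPrimitive
      (hadamardBracket (rayQuot a h k) (γ h) i j
        + unitIntervalCoord *
          hadamardBracket (fun i j => -(rayQuot a h h i j * rayQuot a h k i j)) (γ h) i j
        + hadamardBracketDeriv (rayQuot a h h) (γ h) (fderiv ℂ γ h k) i j) := by
  have hline : HasDerivAt (fun ε : ℂ => h + ε • k) k 0 := by
    simpa using ((hasDerivAt_id (0 : ℂ)).smul_const k).const_add h
  have h0 : h + (0 : ℂ) • k = h := by simp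
  have hg : HasDerivAt (fun ε : ℂ => γ (h + ε • k)) (fderiv ℂ γ h k) 0 := by
    have : HasFDerivAt γ (fderiv ℂ γ h) (h + (0 : ℂ) • k) := h0.symm ▸ hγ.hasFDerivAt
    exact this.comp_hasDerivAt 0 hline
  have hgij (i j : ι) : HasDerivAt (fun ε : ℂ => γ (h + ε • k) i j) (fderiv ℂ γ h k i j) 0 :=
    hasDerivAt_pi.1 (hasDerivAt_pi.1 hg i) j
  have hB : HasDerivAt (fun ε : ℂ => hadamardBracket (rayQuot a (h + ε • k) (h + ε • k))
      (γ (h + ε • k)) i j)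
      (hadamardBracket (rayQuot a h k) (γ h) i j
        + unitIntervalCoord *
          hadamardBracket (fun i j => -(rayQuot a h h i j * rayQuot a h k i j)) (γ h) i j
        + hadamardBracketDeriv (rayQuot a h h) (γ h) (fderiv ℂ γ h k) i j) 0 := by
    simp only [hadamardBracket, hadamardBracketDeriv, Finset.mul_sum, ← Finset.sum_add_distrib]
    refine HasDerivAt.fun_sum fun l _ => ?_
    refine (((hasDerivAt_rayQuot_line hd k l j).fun_sub
      (hasDerivAt_rayQuot_line hd k i l)).fun_mul ((hgij i l).fun_mul (hgij l j))).congr_deriv ?_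
    rw [h0]
    ring
  refine (hgij i j).unique (((unitIntervalPrimitive.hasFDerivAt.comp_hasDerivAt 0 hB).const_add
    (ContinuousMap.const I (b i j))).congr_of_eventuallyEq ?_)
  have ht : Filter.Tendsto (fun ε : ℂ => h + ε • k) (𝓝 0) (𝓝 h) := by
    simpa using hline.continuousAt.tendsto
  filter_upwards [ht.eventually heq] with ε hε
  have := congrFun (congrFun hε i) j
  simp only [rayEquation, Pi.zero_apply, sub_sub, sub_eq_zero] at this
  exact this

theorem fderiv_rayEquation_solution {a : ι → ℂ} {b : ι → ι → ℂ}
    {γ : (ι → ℂ) → ι → ι → C(I, ℂ)} {h : ι → ℂ} (hγ : DifferentiableAt ℂ γ h) (hd : ∀ i j, IsUnit (rayDenom a h i j))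
    (heq : ∀ᶠ x in 𝓝 h, rayEquation a b (x, γ x) = 0) (k : ι → ℂ) (i j : ι) :
    fderiv ℂ γ h k i j 1 =
      hadamardBracket (diffQuot (a + h) k) (fun i j => γ h i j 1) i j := by
  have hvar := rayEquation_variation hγ hd heq k
  set v := fderiv ℂ γ h k
  set P : ι → ι → C(I, ℂ) := fun i j => hadamardBracket (rayQuot a h k) (γ h) i j
        + unitIntervalCoord *
          hadamardBracket (fun i j => -(rayQuot a h h i j * rayQuot a h k i j)) (γ h) i j
        + hadamardBracketDeriv (rayQuot a h h) (γ h) v i j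
  set Q : ι → ι → C(I, ℂ) := hadamardBracket (rayQuot a h h) (γ h)
  have hsol (i j : ι) : γ h i j = ContinuousMap.const I (b i j) + unitIntervalPrimitive (Q i j) := by
    have := congrFun (congrFun heq.self_of_nhds i) j
    simpa only [rayEquation, Pi.zero_apply, sub_sub, sub_eq_zero] using this
  let U : ℝ → ι → ι → ℂ := fun t i j => b i j + ∫ s in (0 : ℝ)..t, IccExtend zero_le_one (Q i j) s
  let W : ℝ → ι → ι → ℂ := fun t i j => ∫ s in (0 : ℝ)..t, IccExtend zero_le_one (P i j) s
  have hU (t : I) : U t = fun i j => γ h i j t := by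
    ext i j
    rw [hsol i j]
    rfl
  have hW (t : I) : W t = fun i j => v i j t := by
    ext i j
    rw [hvar i j]
    rfl
  have key := ray_variation_eq (a := a) (h := h) (k := k) (u := U) (v := W)
    (fun t ht => rayDenom_ne hd ⟨t, ht⟩)
    (fun t ht i j => by
      refine ((hasDerivAt_integral_IccExtend (Q i j) ⟨t, ht⟩).const_add (b i j)).congr_deriv ?_
      rw [hU ⟨t, ht⟩]
      simp [Q, hadamardBracket, rayQuot_apply hd, ContinuousMap.sum_apply])
    (fun t ht i j => by
      refine (hasDerivAt_integral_IccExtend (P i j) ⟨t, ht⟩).congr_deriv ?_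
      rw [hU ⟨t, ht⟩, hW ⟨t, ht⟩]
      simp [P, hadamardBracket, hadamardBracketDeriv, rayQuot_apply hd, ContinuousMap.sum_apply,
        unitIntervalCoord])
    (by ext i j; simp [W])
  have hU1 := hU 1
  have hW1 := hW 1
  rw [Icc.coe_one] at hU1 hW1
  rw [hU1, hW1] at key
  exact congrFun (congrFun key i) j

end Ray

end UnitInterval

theorem hadamardBracket_diffQuot_single (n : ℕ) (k : Fin n)
    (B : (Fin n → ℂ) → Matrix (Fin n) (Fin n) ℂ) (a : Fin n → ℂ) (i j : Fin n) :
    hadamardBracket (diffQuot a (Pi.single k 1)) (B a) i j =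
      (B a * isomonodromyThetaK n k B a - isomonodromyThetaK n k B a * B a) i j := by
  have hΘ : isomonodromyThetaK n k B a = of (diffQuot a (Pi.single k 1)) ⊙ B a := by
    ext i j
    simp only [isomonodromyThetaK, of_apply, hadamard_apply, diffQuot, Pi.single_apply]
    split_ifs <;> simp_all [div_eq_mul_inv, mul_comm]
  rw [hΘ, ← hadamardBracket_eq]
  rfl

/-- **Local solvability of the isomonodromy system** [bafi, eq. (4.3)]: through every
initial condition `(a⁰, B⁰)` with `a⁰` having pairwise distinct coordinates there is a
local holomorphic solution `B` of the system `∂B/∂a_k = [B, Θ^(k)]` (the isomonodromy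
connection over `𝔱_reg` is flat, hence locally integrable). -/
theorem isomonodromy_local_solution (n : ℕ) (hn : 1 ≤ n)
    (a0 : Fin n → ℂ) (hdist : ∀ i j : Fin n, i ≠ j → a0 i ≠ a0 j)
    (B0 : Matrix (Fin n) (Fin n) ℂ) :
    ∃ U : Set (Fin n → ℂ), IsOpen U ∧ a0 ∈ U ∧
      U ⊆ {a : Fin n → ℂ | ∀ i j : Fin n, i ≠ j → a i ≠ a j} ∧
      ∃ B : (Fin n → ℂ) → Matrix (Fin n) (Fin n) ℂ,
        B a0 = B0 ∧
        (∀ i j : Fin n, DifferentiableOn ℂ (fun a => B a i j) U) ∧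
        ∀ a ∈ U, ∀ (k i j : Fin n),
          HasDerivAt (fun s : ℂ => B (Function.update a k s) i j)
            ((B a * isomonodromyThetaK n k B a
              - isomonodromyThetaK n k B a * B a) i j) (a k) := by
  obtain ⟨γ, hγ0, hγ⟩ := exists_rayEquation_solution hdist B0
  obtain ⟨V, hV, hVo, hV0⟩ := eventually_nhds_iff.1 hγ
  let B : (Fin n → ℂ) → Matrix (Fin n) (Fin n) ℂ := fun a => of fun i j => γ (a - a0) i j 1
  have hB (a : Fin n → ℂ) (ha : a - a0 ∈ V) (i j : Fin n) : HasFDerivAt (fun a => B a i j)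
      ((ContinuousMap.evalCLM ℂ 1).comp ((ContinuousLinearMap.proj j).comp
        ((ContinuousLinearMap.proj i).comp (fderiv ℂ γ (a - a0))))) a := by
    have h1 := (hV _ ha).1.hasFDerivAt.comp a ((hasFDerivAt_id a).sub_const a0)
    exact (ContinuousMap.evalCLM ℂ 1).hasFDerivAt.comp a
      (hasFDerivAt_pi'.1 (hasFDerivAt_pi'.1 h1 i) j)
  refine ⟨(· - a0) ⁻¹' V, hVo.preimage (by fun_prop), by simpa using hV0, fun a ha i j hij => ?_,
    B, ?_, fun i j a ha => (hB a ha i j).differentiableAt.differentiableWithinAt,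
    fun a ha k i j => ?_⟩
  · simpa using rayDenom_ne (hV _ ha).2.1 1 i j hij
  · ext i j
    simp [B, hγ0]
  · have hself : Function.update a k (a k) = a := Function.update_eq_self k a
    have h1 : HasFDerivAt (fun a => B a i j) _ (Function.update a k (a k)) :=
      hself.symm ▸ hB a ha i j
    refine (h1.comp_hasDerivAt (a k) (hasDerivAt_update a k (a k))).congr_deriv ?_
    have h2 := fderiv_rayEquation_solution (hV _ ha).1 (hV _ ha).2.1
      (Filter.mem_of_superset (hVo.mem_nhds ha) fun x hx => (hV x hx).2.2) (Pi.single k 1) i j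
    rw [add_sub_cancel] at h2
    rw [hself]
    exact h2.trans (hadamardBracket_diffQuot_single n k B a i j)
end
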